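/- arXiv:0712.0785 — 2 statements merged into one kernel-verified Lean document; each statement's English description precedes it below -/
import Mathlib

section
/- For n = 2, ∂Res^h(H₁, H₂) = 0 if and only if the system {H₁ = 0, H₂ = 0} has a nonzero solution in some differential field extension of K; but for n = 3 this equivalence fails: for H₁(U) = u₁' + u₂', H₂(U) = u₁ + u₂, H₃(U) = u₁ + u₁' + u₂', one has ∂Res^h(H₁, H₂, H₃) = 0 while the only common solution of {H₁ = 0, H₂ = 0, H₃ = 0} is the zero solution. -/
universe u

/-- One formal derivation step on the coefficient sequence (in the derivatives of one
differential indeterminate) of a linear differential polynomial. -/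
def dstep {K : Type*} [CommRing K] (dK : K → K) (c : ℕ → K) : ℕ → K :=
  fun k => (if k = 0 then 0 else c (k - 1)) + dK (c k)

/-- Coefficients of the `m`-th derivative of a linear differential polynomial with
coefficient sequence `c`. -/
def dIter {K : Type*} [CommRing K] (dK : K → K) (m : ℕ) (c : ℕ → K) : ℕ → K :=
  (dstep dK)^[m] c

/-- A differential field extension of the differential field `(K, dK)`. -/
structure DiffExt (K : Type u) [Field K] (dK : Derivation ℤ K K) : Type (u + 1) where
  F : Type u
  [fld : Field F]
  ι : K →+* F
  δ : Derivation ℤ F F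
  compat : ∀ x : K, δ (ι x) = ι (dK x)

attribute [instance] DiffExt.fld


/-- A derivation from a domain to its fraction field, given as a ring homomorphism to the
dual numbers, extends to the fraction field. -/
lemma exists_deriv_of_dual {P F : Type*} [CommRing P] [IsDomain P] [Field F] [Algebra P F]
    [IsFractionRing P F] (f1 : P →+* DualNumber F)
    (hf1 : ∀ p, (f1 p).fst = algebraMap P F p) :
    ∃ δ : Derivation ℤ F F, ∀ p, δ (algebraMap P F p) = (f1 p).snd := by
  have hunit : ∀ y : nonZeroDivisors P, IsUnit (f1 y) := by
    intro y
    rw [TrivSqZeroExt.isUnit_iff_isUnit_fst, hf1]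
    exact IsLocalization.map_units F y
  let f : F →+* DualNumber F := IsLocalization.lift hunit
  have hfj : ∀ p, f (algebraMap P F p) = f1 p := fun p => IsLocalization.lift_eq hunit p
  have hf : ∀ x, (f x).fst = x := by
    intro p
    have : ((TrivSqZeroExt.fstHom F F F).toRingHom).comp f = RingHom.id F := by
      apply IsLocalization.ringHom_ext (nonZeroDivisors P)
      refine RingHom.ext fun p => ?_
      exact (congrArg TrivSqZeroExt.fst (hfj p)).trans (hf1 _)
    exact congrArg (fun g => g p) this
  let g : F →+ F :=
      { toFun := fun x => (f x).snd
        map_zero' := by rw [map_zero]; rfl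
        map_add' := by intro x y; rw [map_add]; rfl }
  refine ⟨Derivation.mk' g.toIntLinearMap ?_, ?_⟩
  · intro x y
    change (f (x * y)).snd = x * (f y).snd + y * (f x).snd
    rw [map_mul, TrivSqZeroExt.snd_mul, hf, hf]
    simp [mul_comm]
  · intro p
    change (f (algebraMap P F p)).snd = _
    rw [hfj]

lemma der_leibniz {F : Type*} [Field F] (δ : Derivation ℤ F F) (x y : F) :
    δ (x * y) = x * δ y + y * δ x := δ.leibniz x y

/-- Derivation on the fraction field of a polynomial ring with prescribed values. -/
lemma exists_deriv_mv {K : Type*} [Field K] (dK : Derivation ℤ K K) {I : Type*}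
    (d : I → MvPolynomial I K) {F : Type*} [Field F] [Algebra (MvPolynomial I K) F]
    [IsFractionRing (MvPolynomial I K) F] :
    ∃ δ : Derivation ℤ F F,
      (∀ a, δ (algebraMap (MvPolynomial I K) F (MvPolynomial.C a)) =
        algebraMap (MvPolynomial I K) F (MvPolynomial.C (dK a))) ∧
      ∀ i, δ (algebraMap (MvPolynomial I K) F (MvPolynomial.X i)) =
        algebraMap (MvPolynomial I K) F (d i) := by
  let j := algebraMap (MvPolynomial I K) F
  let f0 : K →+* DualNumber F :=
    { toFun := fun a => (TrivSqZeroExt.inl (j (MvPolynomial.C a)) +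
        TrivSqZeroExt.inr (j (MvPolynomial.C (dK a))))
      map_one' := by ext <;> simp
      map_zero' := by ext <;> simp
      map_mul' := by intro x y; ext <;> simp [mul_comm]
      map_add' := by intro x y; ext <;> simp }
  let f1 : MvPolynomial I K →+* DualNumber F := MvPolynomial.eval₂Hom f0
    (fun i => TrivSqZeroExt.inl (j (MvPolynomial.X i)) + TrivSqZeroExt.inr (j (d i)))
  have hf1 : ∀ p, (f1 p).fst = j p := by
    intro p
    have : ((TrivSqZeroExt.fstHom F F F).toRingHom).comp f1 = j := by
      apply MvPolynomial.ringHom_ext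
      · intro r; simp [f1, f0]
      · intro r; simp [f1]
    exact congrArg (fun g => g p) this
  obtain ⟨δ, hδ⟩ := exists_deriv_of_dual f1 hf1
  refine ⟨δ, fun a => ?_, fun i => ?_⟩
  · rw [hδ]; simp [f1, f0]; rfl
  · rw [hδ]; simp [f1]; rfl

/-- Every differential module embeds in a differential field extension. -/
lemma exists_diffExt {K : Type u} [Field K] (dK : Derivation ℤ K K)
    {M : Type u} [AddCommGroup M] [Module K M] (D : M →+ M)
    (hD : ∀ (a : K) (m : M), D (a • m) = a • D m + dK a • m) :
    ∃ (X : DiffExt K dK) (φ : M →+ X.F), Function.Injective φ ∧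
      (∀ (a : K) m, φ (a • m) = X.ι a * φ m) ∧ ∀ m, φ (D m) = X.δ (φ m) := by
  classical
  let b := Module.Basis.ofVectorSpace K M
  let I := Module.Basis.ofVectorSpaceIndex K M
  let ψ : M →ₗ[K] MvPolynomial I K := b.constr K (fun i => (MvPolynomial.X i : MvPolynomial I K))
  have hb : ∀ i, ψ (b i) = MvPolynomial.X i := fun i => b.constr_basis K _ i
  let j : MvPolynomial I K →+* FractionRing (MvPolynomial I K) := algebraMap _ _
  have hj : Function.Injective j := IsFractionRing.injective _ _
  have hψ : Function.Injective ψ := by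
    have hli : LinearIndependent K (fun i : I => (MvPolynomial.X i : MvPolynomial I K)) :=
      MvPolynomial.linearIndependent_X I K
    intro x y hxy
    apply b.repr.injective
    apply hli
    simpa only [ψ, Module.Basis.constr_apply, ← Finsupp.linearCombination_apply] using hxy
  obtain ⟨δ, hC, hX⟩ := exists_deriv_mv dK (fun i : I => ψ (D (b i)))
    (F := FractionRing (MvPolynomial I K))
  refine ⟨⟨FractionRing (MvPolynomial I K), j.comp MvPolynomial.C, δ, fun x => hC x⟩,
    j.toAddMonoidHom.comp ψ.toAddMonoidHom, ?_, ?_, ?_⟩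
  · exact hj.comp hψ
  · intro a m
    change j (ψ (a • m)) = j (MvPolynomial.C a) * j (ψ m)
    rw [map_smul, MvPolynomial.smul_eq_C_mul, map_mul]
  · intro m
    change j (ψ (D m)) = δ (j (ψ m))
    have key : ∀ m ∈ Submodule.span K (Set.range b), j (ψ (D m)) = δ (j (ψ m)) := by
      intro m hm
      induction hm using Submodule.span_induction with
      | zero => simp only [map_zero]
      | mem x hx =>
        obtain ⟨i, rfl⟩ := hx
        rw [hb, hX]
      | add x y _ _ hx hy => simp only [map_add, hx, hy]
      | smul a x _ hx =>
        rw [hD, map_smul, map_add, map_smul, map_smul, MvPolynomial.smul_eq_C_mul,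
          MvPolynomial.smul_eq_C_mul, MvPolynomial.smul_eq_C_mul, map_mul, map_add, map_mul,
          map_mul, der_leibniz, hx, hC,
          mul_comm (j (ψ x))]
    exact key m (by rw [b.span_eq]; trivial)

open Polynomial in
/-- The formal derivation on linear differential polynomials in one variable, encoded as
polynomials (`X ^ k` standing for the `k`-th derivative). -/
noncomputable def polyD {K : Type*} [Field K] (dK : Derivation ℤ K K) : K[X] →+ K[X] where
  toFun p := X * p + p.sum (fun n a => monomial n (dK a))
  map_zero' := by simp
  map_add' p q := by
    rw [Polynomial.sum_add_index p q _ (by simp) (by simp)]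
    ring

open Polynomial in
lemma coeff_polyD {K : Type*} [Field K] (dK : Derivation ℤ K K) (p : K[X]) :
    (polyD dK p).coeff = dstep dK p.coeff := by
  funext k
  have h : (p.sum (fun n a => monomial n (dK a))).coeff k = dK (p.coeff k) := by
    rw [Polynomial.sum_def, Polynomial.finsetSum_coeff]
    simp only [coeff_monomial]
    rw [Finset.sum_ite_eq']
    split_ifs with hk
    · rfl
    · rw [Polynomial.notMem_support_iff.mp hk, map_zero]
  change (X * p + p.sum (fun n a => monomial n (dK a))).coeff k = _
  rw [coeff_add, h]
  cases k <;> simp [dstep]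

open Polynomial in
lemma coeff_polyD_iter {K : Type*} [Field K] (dK : Derivation ℤ K K) (m : ℕ) (p : K[X]) :
    ((polyD dK)^[m] p).coeff = dIter dK m p.coeff := by
  induction m with
  | zero => rfl
  | succ m ih =>
    rw [Function.iterate_succ_apply', coeff_polyD, ih, dIter, dIter, Function.iterate_succ_apply']

open Polynomial in
lemma polyD_smul {K : Type*} [Field K] (dK : Derivation ℤ K K) (a : K) (p : K[X]) :
    polyD dK (a • p) = a • polyD dK p + dK a • p := by
  ext k
  rw [coeff_polyD]
  simp only [coeff_add, coeff_smul, coeff_polyD, dstep, smul_eq_mul, der_leibniz]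
  split_ifs <;> ring

open Polynomial in
lemma polyD_X_pow {K : Type*} [Field K] (dK : Derivation ℤ K K) (k : ℕ) :
    (polyD dK)^[k] 1 = X ^ k := by
  induction k with
  | zero => rfl
  | succ k ih =>
    rw [Function.iterate_succ_apply', ih]
    ext n
    rw [coeff_polyD, dstep]
    simp only [coeff_X_pow]
    rcases n with _ | n
    · simp; split_ifs <;> simp
    · simp; split_ifs <;> simp

open Polynomial in
lemma degree_polyD {K : Type*} [Field K] (dK : Derivation ℤ K K) (p : K[X]) (n : ℕ)
    (hp : p.degree = n) : (polyD dK p).degree = (n + 1 : ℕ) := by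
  have hc : ∀ k, n < k → p.coeff k = 0 := fun k hk =>
    coeff_eq_zero_of_degree_lt (by rw [hp]; exact_mod_cast hk)
  apply le_antisymm
  · rw [degree_le_iff_coeff_zero]
    intro m hm
    have hm : n + 1 < m := by exact_mod_cast hm
    rw [coeff_polyD, dstep, hc m (by omega), hc (m - 1) (by omega)]
    simp
  · apply le_degree_of_ne_zero
    rw [coeff_polyD, dstep, hc (n + 1) (by omega)]
    simpa using coeff_ne_zero_of_eq_degree hp

open Polynomial in
lemma degree_polyD_iter {K : Type*} [Field K] (dK : Derivation ℤ K K) (p : K[X]) (n : ℕ)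
    (hp : p.degree = n) (m : ℕ) : ((polyD dK)^[m] p).degree = (n + m : ℕ) := by
  induction m with
  | zero => exact hp
  | succ m ih =>
    rw [Function.iterate_succ_apply']
    exact degree_polyD dK _ _ ih

open Polynomial in
/-- The left ideal generated by `p`. -/
noncomputable def leftId {K : Type*} [Field K] (dK : Derivation ℤ K K) (p : K[X]) :
    Submodule K K[X] := Submodule.span K (Set.range fun j : ℕ => (polyD dK)^[j] p)

open Polynomial in
lemma leftId_stable {K : Type*} [Field K] (dK : Derivation ℤ K K) (p q : K[X])
    (hq : q ∈ leftId dK p) : polyD dK q ∈ leftId dK p := by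
  induction hq using Submodule.span_induction with
  | zero => simp
  | mem x hx =>
    obtain ⟨i, rfl⟩ := hx
    apply Submodule.subset_span
    exact ⟨i + 1, Function.iterate_succ_apply' _ _ _⟩
  | add x y _ _ hx hy => rw [map_add]; exact add_mem hx hy
  | smul a x hx' hx =>
    rw [polyD_smul]
    exact add_mem (Submodule.smul_mem _ _ hx) (Submodule.smul_mem _ _ hx')

open Polynomial in
lemma leftId_le {K : Type*} [Field K] (dK : Derivation ℤ K K) (p q : K[X])
    (hq : q ∈ leftId dK p) : leftId dK q ≤ leftId dK p := by
  apply Submodule.span_le.mpr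
  rintro _ ⟨i, rfl⟩
  change (polyD dK)^[i] q ∈ leftId dK p
  induction i with
  | zero => exact hq
  | succ m ih =>
    rw [Function.iterate_succ_apply']
    exact leftId_stable dK _ _ ih

open Polynomial in
/-- degree sequence adapted to `p` -/
noncomputable def polySeq {K : Type*} [Field K] (dK : Derivation ℤ K K) (p : K[X]) (n : ℕ)
    (hp : p.degree = n) : Polynomial.Sequence K where
  elems' i := if i < n then X ^ i else (polyD dK)^[i - n] p
  degree_eq' i := by
    split_ifs with h
    · simp
    · rw [degree_polyD_iter dK p n hp]
      congr 1; omega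

open Polynomial in
lemma leftId_isCompl {K : Type*} [Field K] (dK : Derivation ℤ K K) (p : K[X]) (n : ℕ)
    (hp : p.degree = n) : IsCompl (leftId dK p) (degreeLT K n) := by
  set S := polySeq dK p n hp
  have hS : ∀ i, S i = if i < n then X ^ i else (polyD dK)^[i - n] p := fun i => rfl
  have hu : ∀ i, IsUnit (S i).leadingCoeff := fun i => by simp
  have h1 : leftId dK p = Submodule.span K (S '' Set.Ici n) := by
    unfold leftId
    congr 1
    ext q
    constructor
    · rintro ⟨j, rfl⟩
      exact ⟨n + j, by simp, by simp [hS]⟩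
    · rintro ⟨j, hj, rfl⟩
      have hj : n ≤ j := hj
      exact ⟨j - n, by simp [hS, hj]⟩
  rw [h1, ← S.span_degreeLT (fun i _ => hu i)]
  constructor
  · apply S.linearIndependent.disjoint_span_image
    rw [Set.disjoint_left]
    intro a ha hb
    simp at ha hb; omega
  · rw [codisjoint_iff, ← Submodule.span_union, ← Set.image_union]
    have : Set.Ici n ∪ Set.Iio n = Set.univ := by ext; simp
    rw [this, Set.image_univ, S.span hu]

open Polynomial in
lemma leftId_quot {K : Type*} [Field K] (dK : Derivation ℤ K K) (p : K[X]) (n : ℕ)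
    (hp : p.degree = n) : Nonempty ((K[X] ⧸ leftId dK p) ≃ₗ[K] (Fin n → K)) :=
  ⟨(Submodule.quotientEquivOfIsCompl _ _ (leftId_isCompl dK p n hp)).trans (degreeLTEquiv K n)⟩

open Polynomial in
/-- If `p`, `q` generate everything, a common left multiple has order at least the sum. -/
lemma lclm_order {K : Type*} [Field K] (dK : Derivation ℤ K K) (p q r : K[X]) (m n l : ℕ)
    (hp : p.degree = m) (hq : q.degree = n) (hr : r.degree = l)
    (htop : leftId dK p ⊔ leftId dK q = ⊤) (h1 : r ∈ leftId dK p) (h2 : r ∈ leftId dK q) :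
    m + n ≤ l := by
  obtain ⟨e1⟩ := leftId_quot dK p m hp
  obtain ⟨e2⟩ := leftId_quot dK q n hq
  obtain ⟨e3⟩ := leftId_quot dK r l hr
  let f : (K[X] ⧸ leftId dK r) →ₗ[K] ((K[X] ⧸ leftId dK p) × (K[X] ⧸ leftId dK q)) :=
    LinearMap.prod (Submodule.factor (leftId_le dK p r h1))
      (Submodule.factor (leftId_le dK q r h2))
  have hf : Function.Surjective f := by
    rintro ⟨a, b⟩
    obtain ⟨a, rfl⟩ := Submodule.mkQ_surjective _ a
    obtain ⟨b, rfl⟩ := Submodule.mkQ_surjective _ b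
    have hab : a - b ∈ leftId dK p ⊔ leftId dK q := by rw [htop]; trivial
    obtain ⟨x, hx, y, hy, hxy⟩ := Submodule.mem_sup.mp hab
    refine ⟨Submodule.mkQ _ (a - x), ?_⟩
    apply Prod.ext
    · change Submodule.mkQ _ (a - x) = Submodule.mkQ _ a
      simpa using hx
    · change Submodule.mkQ _ (a - x) = Submodule.mkQ _ b
      have : a - x = b + y := by linear_combination -hxy
      rw [this]
      simpa using hy
  have : Module.Finite K (K[X] ⧸ leftId dK r) := Module.Finite.equiv e3.symm
  have : Module.Finite K (K[X] ⧸ leftId dK p) := Module.Finite.equiv e1.symm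
  have : Module.Finite K (K[X] ⧸ leftId dK q) := Module.Finite.equiv e2.symm
  have := LinearMap.finrank_le_finrank_of_surjective hf
  rw [Module.finrank_prod, e1.finrank_eq, e2.finrank_eq, e3.finrank_eq] at this
  simpa using this

open Polynomial in
lemma polyD_monomial {K : Type*} [Field K] (dK : Derivation ℤ K K) (n : ℕ) (a : K) :
    polyD dK (monomial n a) = monomial (n + 1) a + monomial n (dK a) := by
  change X * monomial n a + (monomial n a).sum (fun n a => monomial n (dK a)) = _
  rw [X_mul_monomial, sum_monomial_index _ _ (by simp)]

open Polynomial in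
/-- Evaluation of a linear differential polynomial at an element of an extension. -/
noncomputable def evalD {K : Type u} [Field K] {dK : Derivation ℤ K K} (X : DiffExt K dK)
    (τ : X.F) : K[X] →+ X.F where
  toFun p := p.sum (fun k a => X.ι a * (⇑X.δ)^[k] τ)
  map_zero' := by simp
  map_add' p q := Polynomial.sum_add_index p q _ (by simp) (by intros; rw [map_add, add_mul])

open Polynomial in
lemma evalD_apply {K : Type u} [Field K] {dK : Derivation ℤ K K} (X : DiffExt K dK)
    (τ : X.F) (p : K[X]) (n : ℕ) (hn : p.natDegree < n) :
    evalD X τ p = ∑ k ∈ Finset.range n, X.ι (p.coeff k) * (⇑X.δ)^[k] τ :=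
  Polynomial.sum_over_range' (f := fun k a => X.ι a * (⇑X.δ)^[k] τ) p (by simp) n hn

open Polynomial in
lemma evalD_monomial {K : Type u} [Field K] {dK : Derivation ℤ K K} (X : DiffExt K dK)
    (τ : X.F) (n : ℕ) (a : K) : evalD X τ (monomial n a) = X.ι a * (⇑X.δ)^[n] τ :=
  Polynomial.sum_monomial_index _ (fun k a => X.ι a * (⇑X.δ)^[k] τ) (by simp)

open Polynomial in
lemma evalD_polyD {K : Type u} [Field K] {dK : Derivation ℤ K K} (X : DiffExt K dK)
    (τ : X.F) (p : K[X]) : evalD X τ (polyD dK p) = X.δ (evalD X τ p) := by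
  induction p using Polynomial.induction_on' with
  | add p q hp hq => simp only [map_add, hp, hq]
  | monomial n a =>
    rw [polyD_monomial, map_add, evalD_monomial, evalD_monomial, evalD_monomial, der_leibniz,
      X.compat, Function.iterate_succ_apply']
    ring

open Polynomial in
lemma evalD_polyD_iter {K : Type u} [Field K] {dK : Derivation ℤ K K} (X : DiffExt K dK)
    (τ : X.F) (p : K[X]) (hp : evalD X τ p = 0) (m : ℕ) :
    evalD X τ ((polyD dK)^[m] p) = 0 := by
  induction m with
  | zero => exact hp
  | succ m ih => rw [Function.iterate_succ_apply', evalD_polyD, ih, map_zero]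

open Polynomial in
lemma exists_solution {K : Type u} [Field K] (dK : Derivation ℤ K K) (p q : K[X])
    (h : leftId dK p ⊔ leftId dK q ≠ ⊤) :
    ∃ (X : DiffExt K dK) (τ : X.F), τ ≠ 0 ∧ evalD X τ p = 0 ∧ evalD X τ q = 0 := by
  set I := leftId dK p ⊔ leftId dK q with hI
  have hst : ∀ x ∈ I, polyD dK x ∈ I := by
    intro x hx
    obtain ⟨y, hy, z, hz, rfl⟩ := Submodule.mem_sup.mp hx
    rw [map_add]
    exact add_mem (Submodule.mem_sup_left (leftId_stable _ _ _ hy))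
      (Submodule.mem_sup_right (leftId_stable _ _ _ hz))
  let D : (K[X] ⧸ I) →+ (K[X] ⧸ I) :=
    QuotientAddGroup.map I.toAddSubgroup I.toAddSubgroup (polyD dK) hst
  have hDm : ∀ x, D (I.mkQ x) = I.mkQ (polyD dK x) := fun x => rfl
  have hD : ∀ (a : K) (m : K[X] ⧸ I), D (a • m) = a • D m + dK a • m := by
    intro a m
    obtain ⟨m, rfl⟩ := Submodule.mkQ_surjective _ m
    rw [← map_smul, hDm, hDm, polyD_smul, map_add, map_smul, map_smul]
  obtain ⟨X, φ, hφ, hφs, hφD⟩ := exists_diffExt dK D hD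
  have hpow : ∀ k, (⇑X.δ)^[k] (φ (I.mkQ 1)) = φ (I.mkQ (Polynomial.X ^ k)) := by
    intro k
    rw [← polyD_X_pow dK k]
    induction k with
    | zero => rfl
    | succ k ih =>
      rw [Function.iterate_succ_apply', Function.iterate_succ_apply', ih, ← hφD, hDm]
  have hev : ∀ r, evalD X (φ (I.mkQ 1)) r = φ (I.mkQ r) := by
    intro r
    induction r using Polynomial.induction_on' with
    | add p q hp hq => simp only [map_add, hp, hq]
    | monomial n a =>
      rw [evalD_monomial, hpow, ← hφs, ← map_smul, Polynomial.smul_X_eq_monomial]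
  have hz : ∀ r ∈ I, evalD X (φ (I.mkQ 1)) r = 0 := by
    intro r hr
    rw [hev, (Submodule.Quotient.mk_eq_zero I).mpr hr |> (show I.mkQ r = 0 from ·), map_zero]
  refine ⟨X, φ (I.mkQ 1), ?_, hz p ?_, hz q ?_⟩
  · intro h0
    apply h
    rw [eq_top_iff]
    intro r _
    have h1 := hev r
    have h2 : evalD X (φ (I.mkQ 1)) r = 0 := by
      rw [h0, evalD_apply X 0 r _ (Nat.lt_succ_self _)]
      apply Finset.sum_eq_zero
      intro k _
      have : ∀ k, (⇑X.δ)^[k] 0 = 0 := by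
        intro k
        induction k with
        | zero => rfl
        | succ k ih => rw [Function.iterate_succ_apply', ih, map_zero]
      rw [this, mul_zero]
    rw [h2] at h1
    have h3 : I.mkQ r = 0 := hφ (by rw [← h1, map_zero])
    simpa using h3
  · exact Submodule.mem_sup_left (Submodule.subset_span ⟨0, rfl⟩)
  · exact Submodule.mem_sup_right (Submodule.subset_span ⟨0, rfl⟩)

open Polynomial in
lemma indep_iter {K : Type*} [Field K] (dK : Derivation ℤ K K) (p : K[X]) (n : ℕ)
    (hp : p.degree = n) : LinearIndependent K (fun j : ℕ => (polyD dK)^[j] p) := by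
  have h := (polySeq dK p n hp).linearIndependent.comp (fun j => n + j) (add_right_injective n)
  have h2 : (fun j : ℕ => (polyD dK)^[j] p) = (polySeq dK p n hp) ∘ (fun j => n + j) := by
    funext j
    change _ = if n + j < n then X ^ (n + j) else (polyD dK)^[n + j - n] p
    simp
  rw [h2]
  exact h

open Polynomial in
lemma part_one {K : Type u} [Field K] (dK : Derivation ℤ K K) (o : Fin 2 → ℕ) (P : Fin 2 → K[X])
    (hP : ∀ i, (P i).degree = o i) :
    ((∀ e : Fin (o 0 + o 1) ≃ (Σ i : Fin 2, Fin (o 0 + o 1 - o i)),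
          Matrix.det (Matrix.of fun p q : Fin (o 0 + o 1) =>
            ((polyD dK)^[((e p).2 : ℕ)] (P (e p).1)).coeff (q : ℕ)) = 0) ↔
        ∃ (X : DiffExt K dK) (τ : X.F), τ ≠ 0 ∧ ∀ i, evalD X τ (P i) = 0) := by
  have hdeg : ∀ s : (Σ i : Fin 2, Fin (o 0 + o 1 - o i)),
      ((polyD dK)^[(s.2 : ℕ)] (P s.1)).degree < (o 0 + o 1 : ℕ) := by
    rintro ⟨i, j⟩
    rw [degree_polyD_iter dK _ _ (hP i)]
    have := j.2
    have h : o i + j < o 0 + o 1 := by omega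
    exact_mod_cast h
  constructor
  · intro hdet
    by_cases htop : leftId dK (P 0) ⊔ leftId dK (P 1) = ⊤
    swap
    · obtain ⟨X, τ, h0, h1, h2⟩ := exists_solution dK _ _ htop
      exact ⟨X, τ, h0, by intro i; fin_cases i <;> assumption⟩
    exfalso
    have hcard : Fintype.card (Fin (o 0 + o 1)) =
        Fintype.card (Σ i : Fin 2, Fin (o 0 + o 1 - o i)) := by
      simp [Fintype.card_sigma, Fin.sum_univ_two]; omega
    have e := Fintype.equivOfCardEq hcard
    obtain ⟨v, hv, hvM⟩ := Matrix.exists_vecMul_eq_zero_iff.mpr (hdet e)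
    let w := fun s => v (e.symm s)
    have hsum : ∑ s, w s • (polyD dK)^[(s.2 : ℕ)] (P s.1) = 0 := by
      ext k
      rw [Polynomial.finsetSum_coeff, coeff_zero]
      by_cases hk : k < o 0 + o 1
      · have h1 := congrFun hvM ⟨k, hk⟩
        rw [← e.sum_comp]
        simpa [Matrix.vecMul, dotProduct, w] using h1
      · apply Finset.sum_eq_zero
        intro s _
        rw [coeff_smul, coeff_eq_zero_of_degree_lt, smul_zero]
        refine (hdeg s).trans_le ?_
        exact_mod_cast not_lt.mp hk
    rw [Fintype.sum_sigma, Fin.sum_univ_two] at hsum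
    have hmem : ∀ i, ∑ j, w ⟨i, j⟩ • (polyD dK)^[(j : ℕ)] (P i) ∈ leftId dK (P i) := fun i =>
      Submodule.sum_mem _ fun j _ => Submodule.smul_mem _ _ (Submodule.subset_span ⟨j, rfl⟩)
    have hzero : ∀ i, ∑ j, w ⟨i, j⟩ • (polyD dK)^[(j : ℕ)] (P i) = 0 → ∀ j, w ⟨i, j⟩ = 0 := by
      intro i hi
      have := (indep_iter dK (P i) _ (hP i)).comp (fun j : Fin (o 0 + o 1 - o i) => (j : ℕ))
        Fin.val_injective
      exact Fintype.linearIndependent_iff.mp this _ hi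
    set C := ∑ j, w ⟨0, j⟩ • (polyD dK)^[(j : ℕ)] (P 0) with hC
    have hC2 : C ∈ leftId dK (P 1) := by
      rw [eq_neg_of_add_eq_zero_left hsum]
      exact neg_mem (hmem 1)
    have hC0 : C ≠ 0 := by
      intro h0
      have h1 := hzero 0 h0
      rw [h0, zero_add] at hsum
      have h2 := hzero 1 hsum
      apply hv
      funext x
      have : ∀ s, w s = 0 := by
        rintro ⟨i, j⟩
        fin_cases i
        · exact h1 j
        · exact h2 j
      simpa [w] using this (e x)
    have hlt : C.degree < (o 0 + o 1 : ℕ) := by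
      rw [← Polynomial.mem_degreeLT]
      exact Submodule.sum_mem _ fun j _ => Submodule.smul_mem _ _
        (Polynomial.mem_degreeLT.mpr (hdeg ⟨0, j⟩))
    rw [degree_eq_natDegree hC0] at hlt
    have := lclm_order dK _ _ C _ _ _ (hP 0) (hP 1) (degree_eq_natDegree hC0) htop (hmem 0) hC2
    have hlt : C.natDegree < o 0 + o 1 := by exact_mod_cast hlt
    omega
  · rintro ⟨X, τ, hτ, hsol⟩ e
    have hN : 0 < o 0 + o 1 := by
      by_contra hN
      have h0 : o 0 = 0 := by omega
      have h1 := hsol 0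
      have h2 := hP 0
      rw [h0] at h2
      have h3 := eq_C_of_degree_eq_zero h2
      rw [h3, ← monomial_zero_left, evalD_monomial] at h1
      have h4 : (P 0).coeff 0 = 0 := by
        have h5 := (mul_eq_zero.mp h1).resolve_right hτ
        exact (map_eq_zero X.ι).mp h5
      rw [h4, C_0] at h3
      rw [h3] at h2
      simp at h2
    apply X.ι.injective
    rw [map_zero, RingHom.map_det, ← Matrix.exists_mulVec_eq_zero_iff]
    refine ⟨fun q => (⇑X.δ)^[(q : ℕ)] τ, fun h => hτ (congrFun h ⟨0, hN⟩), ?_⟩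
    funext x
    have h1 := evalD_polyD_iter X τ _ (hsol (e x).1) (e x).2
    rw [evalD_apply X τ _ (o 0 + o 1), Finset.sum_range] at h1
    · exact h1
    · have hd := hdeg (e x)
      have hne : (polyD dK)^[((e x).2 : ℕ)] (P (e x).1) ≠ 0 := by
        intro h0
        have h3 := degree_polyD_iter dK _ _ (hP (e x).1) (e x).2
        rw [h0, degree_zero] at h3
        exact WithBot.bot_ne_coe h3
      rw [degree_eq_natDegree hne] at hd
      exact_mod_cast hd

/-- (a) For `n = 2`, `∂Res^h(H₁,H₂) = 0` iff `{H₁ = 0, H₂ = 0}` has a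
nonzero solution in some differential field extension of `K`.  (b) For `n = 3` this fails:
for `H₁ = u₁' + u₂'`, `H₂ = u₁ + u₂`, `H₃ = u₁ + u₁' + u₂'` one has
`∂Res^h(H₁,H₂,H₃) = 0` (orders `o = (1,0,1)`, `N = 2`) while the only common solution of
`{H₁ = 0, H₂ = 0, H₃ = 0}` in any differential field extension is the zero one. -/
theorem homres_vanish_iff_n2_and_counterexample_n3
    {K : Type u} [Field K] (dK : Derivation ℤ K K) :
    (∀ (o : Fin 2 → ℕ) (c : Fin 2 → ℕ → K),
      (∀ i k, o i < k → c i k = 0) → (∀ i, c i (o i) ≠ 0) →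
      ((∀ e : Fin (o 0 + o 1) ≃ (Σ i : Fin 2, Fin (o 0 + o 1 - o i)),
          Matrix.det (Matrix.of fun p q : Fin (o 0 + o 1) =>
            dIter (⇑dK) ((e p).2 : ℕ) (c (e p).1) (q : ℕ)) = 0) ↔
        ∃ (X : DiffExt K dK) (τ : X.F), τ ≠ 0 ∧
          ∀ i, ∑ k ∈ Finset.range (o i + 1), X.ι (c i k) * (⇑X.δ)^[k] τ = 0)) ∧
    (∀ e : (Fin 2 × Fin 2) ≃ (Σ i : Fin 3, Fin (2 - (![1, 0, 1] : Fin 3 → ℕ) i)),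
      Matrix.det (Matrix.of fun p q : Fin 2 × Fin 2 =>
        dIter (⇑dK) ((e p).2 : ℕ)
          ((![![fun k => if k = 1 then 1 else 0, fun k => if k = 1 then 1 else 0],
              ![fun k => if k = 0 then 1 else 0, fun k => if k = 0 then 1 else 0],
              ![fun k => if k ≤ 1 then 1 else 0, fun k => if k = 1 then 1 else 0]] :
            Fin 3 → Fin 2 → ℕ → K) (e p).1 q.1) (q.2 : ℕ)) = 0) ∧
    (∀ (X : DiffExt K dK) (τ₁ τ₂ : X.F),
      X.δ τ₁ + X.δ τ₂ = 0 → τ₁ + τ₂ = 0 → τ₁ + X.δ τ₁ + X.δ τ₂ = 0 →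
      τ₁ = 0 ∧ τ₂ = 0) := by
  refine ⟨?_, ?_, ?_⟩
  · intro o c hc hc0
    let P : Fin 2 → Polynomial K := fun i =>
      ∑ k ∈ Finset.range (o i + 1), Polynomial.monomial k (c i k)
    have hco : ∀ i, (P i).coeff = c i := by
      intro i
      funext k
      simp only [P, Polynomial.finsetSum_coeff, Polynomial.coeff_monomial]
      rw [Finset.sum_ite_eq']
      split_ifs with h
      · rfl
      · exact (hc i k (by simpa using h)).symm
    have hP : ∀ i, (P i).degree = o i := by
      intro i
      apply le_antisymm
      · rw [Polynomial.degree_le_iff_coeff_zero]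
        intro m hm
        rw [hco]
        exact hc i m (by exact_mod_cast hm)
      · apply Polynomial.le_degree_of_ne_zero
        rw [hco]
        exact hc0 i
    have h := part_one dK o P hP
    simp only [coeff_polyD_iter, hco] at h
    rw [h]
    have hev : ∀ (X : DiffExt K dK) (τ : X.F) (i : Fin 2), evalD X τ (P i) =
        ∑ k ∈ Finset.range (o i + 1), X.ι (c i k) * (⇑X.δ)^[k] τ := by
      intro X τ i
      rw [evalD_apply X τ _ (o i + 1), hco]
      rw [Polynomial.natDegree_eq_of_degree_eq_some (hP i)]
      exact Nat.lt_succ_self _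
    simp only [hev]
  · intro e
    apply Matrix.det_zero_of_column_eq (i := ((0, 1) : Fin 2 × Fin 2)) (j := (1, 1)) (by decide)
    intro k
    rw [Matrix.of_apply, Matrix.of_apply]
    generalize e k = s
    obtain ⟨i, j⟩ := s
    fin_cases i
    · rfl
    · rfl
    · have hj : (j : ℕ) = 0 := by
        have := j.2
        simp at this
        omega
      simp [hj, dIter]
  · intro X a b h1 h2 h3
    have ha : a = 0 := by linear_combination h3 - h1
    exact ⟨ha, by linear_combination h2 - ha⟩
end

section
/- Consider the two-equation system x₁ = a₁ − L₁(u), x₂ = a₂ − L₂(u) with L₁, L₂ ∈ K[∂] of orders o₁, o₂ and gcrd(L₁, L₂) = 1. Then there exist D₁, D₂ ∈ K[∂] with deg D_i ≤ o_i − 1 such that ∂Res(F₁, F₂)(x₁, x₂) = (−1)^a · ∂Res^h(H₁, H₂) · [(L₂ − D₂)(x₁ − a₁) − (L₁ − D₁)(x₂ − a₂)] for some a ∈ ℕ, where F_i = x_i − a_i + L_i(u) and H_i = L_i(u); in particular the polynomial (L₂−D₂)(x₁−a₁) − (L₁−D₁)(x₂−a₂) vanishes identically under the substitution x_i ↦ a_i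 − L_i(u). -/
/-- The action on `x` of the differential operator `∑_{i ≤ dp} p i · ∂^i`. -/
def Lop {K : Type*} [Field K] {E : Type*} [CommRing E] [Algebra K E]
    (δ : Derivation ℤ E E) (p : ℕ → K) (dp : ℕ) (x : E) : E :=
  ∑ i ∈ Finset.range (dp + 1), algebraMap K E (p i) * (⇑δ)^[i] x

/-- `(E, δ)` is a differential algebra over the differential field `(K, dK)`. -/
def Compat {K : Type*} [Field K] (dK : Derivation ℤ K K) {E : Type*} [CommRing E]
    [Algebra K E] (δ : Derivation ℤ E E) : Prop :=
  ∀ x : K, δ (algebraMap K E x) = algebraMap K E (dK x)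

section Helpers

variable {K : Type*} [Field K] (dK : Derivation ℤ K K)

/-- coefficients of the product operator `A * L` -/
def opMul (s : ℕ) (A L : ℕ → K) (q : ℕ) : K :=
  ∑ m ∈ Finset.range (s + 1), A m * dIter (⇑dK) m L q

lemma dIter_succ_apply (m : ℕ) (L : ℕ → K) :
    dIter (⇑dK) (m + 1) L = dstep (⇑dK) (dIter (⇑dK) m L) := by
  simp only [dIter, Function.iterate_succ_apply']

lemma dstep_supp {L : ℕ → K} {o : ℕ} (h : ∀ m, o < m → L m = 0) :
    ∀ m, o + 1 < m → dstep (⇑dK) L m = 0 := by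
  intro m hm
  have h0 : m ≠ 0 := by omega
  simp [dstep, h0, h m (by omega), h (m - 1) (by omega)]

lemma dstep_lead {L : ℕ → K} {o : ℕ} (h : ∀ m, o < m → L m = 0) :
    dstep (⇑dK) L (o + 1) = L o := by
  simp [dstep, h (o + 1) (by omega)]

lemma dIter_supp {L : ℕ → K} {o : ℕ} (h : ∀ m, o < m → L m = 0) (k : ℕ) :
    ∀ m, k + o < m → dIter (⇑dK) k L m = 0 := by
  induction k with
  | zero => intro m hm; simpa [dIter] using h m (by omega)
  | succ k ih =>
    intro m hm
    rw [dIter_succ_apply]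
    exact dstep_supp dK ih m (by omega)

lemma dIter_lead {L : ℕ → K} {o : ℕ} (h : ∀ m, o < m → L m = 0) (k : ℕ) :
    dIter (⇑dK) k L (k + o) = L o := by
  induction k with
  | zero => simp [dIter]
  | succ k ih =>
    rw [dIter_succ_apply, show k + 1 + o = (k + o) + 1 by ring,
      dstep_lead dK (dIter_supp dK h k), ih]

lemma opMul_supp {A L : ℕ → K} {s o : ℕ} (h : ∀ m, o < m → L m = 0) :
    ∀ q, s + o < q → opMul dK s A L q = 0 := by
  intro q hq
  refine Finset.sum_eq_zero fun m hm => ?_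
  rw [Finset.mem_range] at hm
  rw [dIter_supp dK h m q (by omega), mul_zero]

lemma opMul_lead {A L : ℕ → K} {s o : ℕ} (h : ∀ m, o < m → L m = 0) :
    opMul dK s A L (s + o) = A s * L o := by
  rw [opMul, Finset.sum_range_succ, dIter_lead dK h, Finset.sum_eq_zero, zero_add]
  intro m hm
  rw [Finset.mem_range] at hm
  rw [dIter_supp dK h m _ (by omega), mul_zero]

lemma opMul_ext {A L : ℕ → K} {s t : ℕ} (hst : s ≤ t) (hA : ∀ m, s < m → A m = 0) (q : ℕ) :
    opMul dK t A L q = opMul dK s A L q := by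
  symm
  refine Finset.sum_subset (by intro x; simp; omega) ?_
  intro m _ hm
  rw [Finset.mem_range] at hm
  rw [hA m (by omega), zero_mul]

lemma opMul_dstep {A L : ℕ → K} {s : ℕ} (hA : ∀ m, s < m → A m = 0) (q : ℕ) :
    opMul dK (s + 1) (dstep (⇑dK) A) L q = dstep (⇑dK) (opMul dK s A L) q := by
  have e1 : opMul dK (s + 1) (dstep (⇑dK) A) L q =
      ∑ m ∈ Finset.range (s + 1), A m * dIter (⇑dK) (m + 1) L q +
      ∑ m ∈ Finset.range (s + 1), dK (A m) * dIter (⇑dK) m L q := by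
    simp only [opMul, dstep, add_mul, Finset.sum_add_distrib]
    congr 1
    · rw [Finset.sum_range_succ']; simp
    · rw [Finset.sum_range_succ]; simp [hA (s + 1) (by omega)]
  rw [e1]
  simp only [dIter_succ_apply, dstep, opMul, mul_add, Finset.sum_add_distrib, map_sum,
    Derivation.leibniz, smul_eq_mul]
  by_cases h : q = 0
  · simp [h, mul_comm]
  · simp only [h, if_false]
    rw [add_assoc]
    congr 2
    exact Finset.sum_congr rfl fun m _ => mul_comm _ _

/-- multiply up a syzygy until it has full order -/
lemma syz_up {L₁ L₂ : ℕ → K} {o₁ o₂ : ℕ} (k : ℕ) : ∀ (s t : ℕ) (A B : ℕ → K),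
    s + k = o₂ → t + k = o₁ → (∀ m, s < m → A m = 0) → (∀ m, t < m → B m = 0) → A s ≠ 0 →
    (∀ q, opMul dK s A L₁ q = opMul dK t B L₂ q) →
    ∃ A B : ℕ → K, (∀ m, o₂ < m → A m = 0) ∧ (∀ m, o₁ < m → B m = 0) ∧ A o₂ ≠ 0 ∧
      (∀ q, opMul dK o₂ A L₁ q = opMul dK o₁ B L₂ q) := by
  induction k with
  | zero =>
    intro s t A B hs ht hA hB h0 h
    obtain rfl : s = o₂ := by omega
    obtain rfl : t = o₁ := by omega
    exact ⟨A, B, hA, hB, h0, h⟩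
  | succ k ih =>
    intro s t A B hs ht hA hB h0 h
    refine ih (s + 1) (t + 1) (dstep (⇑dK) A) (dstep (⇑dK) B) (by omega) (by omega)
      (dstep_supp dK hA) (dstep_supp dK hB) (by rwa [dstep_lead dK hA]) ?_
    intro q
    rw [opMul_dstep dK hA, opMul_dstep dK hB, funext h]

lemma exists_deg {A : ℕ → K} {s : ℕ} (hA : ∀ m, s < m → A m = 0) :
    (∀ m, A m = 0) ∨ ∃ d, d ≤ s ∧ A d ≠ 0 ∧ ∀ m, d < m → A m = 0 := by
  induction s with
  | zero =>
    by_cases h : A 0 = 0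
    · left; intro m
      rcases Nat.eq_zero_or_pos m with rfl | hm
      · exact h
      · exact hA m hm
    · exact Or.inr ⟨0, le_rfl, h, hA⟩
  | succ s ih =>
    by_cases h : A (s + 1) = 0
    · rcases ih (fun m hm => by
        rcases Nat.eq_or_lt_of_le (Nat.succ_le_of_lt hm) with e | e
        · rw [← e]; exact h
        · exact hA m e) with h | ⟨d, h1, h2⟩
      · exact Or.inl h
      · exact Or.inr ⟨d, by omega, h2⟩
    · exact Or.inr ⟨_, le_rfl, h, hA⟩

lemma opMul_zero {A L : ℕ → K} (s : ℕ) (hA : ∀ m, A m = 0) (q : ℕ) : opMul dK s A L q = 0 := by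
  simp [opMul, hA]

lemma exists_syz0 {L₁ L₂ : ℕ → K} {o₁ o₂ : ℕ}
    (h₁' : ∀ m, o₁ < m → L₁ m = 0) (h₂' : ∀ m, o₂ < m → L₂ m = 0) :
    ∃ A B : ℕ → K, (∀ m, o₂ < m → A m = 0) ∧ (∀ m, o₁ < m → B m = 0) ∧
      (¬ ((∀ m, A m = 0) ∧ (∀ m, B m = 0))) ∧
      (∀ q, opMul dK o₂ A L₁ q = opMul dK o₁ B L₂ q) := by
  let N : Matrix (Fin ((o₂ + 1) + (o₁ + 1))) (Fin ((o₂ + 1) + (o₁ + 1))) K :=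
    Matrix.of fun r q =>
      if (q : ℕ) < o₁ + o₂ + 1 then
        (if (r : ℕ) < o₂ + 1 then dIter (⇑dK) (r : ℕ) L₁ (q : ℕ)
          else dIter (⇑dK) ((r : ℕ) - (o₂ + 1)) L₂ (q : ℕ))
      else 0
  have hdet : N.det = 0 := by
    refine Matrix.det_eq_zero_of_column_eq_zero (⟨o₁ + o₂ + 1, by omega⟩) ?_
    intro i
    simp [N]
  obtain ⟨v, hv0, hv⟩ := Matrix.exists_vecMul_eq_zero_iff.mpr hdet
  let w : ℕ → K := fun m => if h : m < (o₂ + 1) + (o₁ + 1) then v ⟨m, h⟩ else 0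
  have hw : ∀ r : Fin ((o₂ + 1) + (o₁ + 1)), v r = w r := by intro r; simp [w]
  refine ⟨fun m => if m < o₂ + 1 then w m else 0, fun m => - w (o₂ + 1 + m), ?_, ?_, ?_, ?_⟩
  · intro m hm; simp; omega
  · intro m hm
    have : ¬ (o₂ + 1 + m < (o₂ + 1) + (o₁ + 1)) := by omega
    simp only [w, this, dif_neg, not_false_eq_true, neg_zero]
  · rintro ⟨hA, hB⟩
    apply hv0
    funext r
    rw [hw]
    by_cases hr : (r : ℕ) < o₂ + 1
    · have := hA r
      simpa [hr] using this
    · have := hB (r - (o₂ + 1))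
      simp only [] at this
      rw [Nat.add_sub_cancel' (show o₂ + 1 ≤ (r : ℕ) by omega)] at this
      simpa using this
  · intro q
    by_cases hq : q < o₁ + o₂ + 1
    · have := congrFun hv ⟨q, by omega⟩
      simp only [Matrix.vecMul, dotProduct, N, Matrix.of_apply, hq, if_true, hw,
        Pi.zero_apply] at this
      rw [Fin.sum_univ_eq_sum_range (fun r => w r * (if r < o₂ + 1 then dIter (⇑dK) r L₁ q
          else dIter (⇑dK) (r - (o₂ + 1)) L₂ q)) , Finset.sum_range_add] at this
      rw [← sub_eq_zero, ← this, sub_eq_add_neg, opMul, opMul, ← Finset.sum_neg_distrib]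
      congr 1
      · refine Finset.sum_congr rfl fun m hm => ?_
        rw [Finset.mem_range] at hm
        simp [hm]
      · refine Finset.sum_congr rfl fun m hm => ?_
        rw [if_neg (show ¬ (o₂ + 1 + m < o₂ + 1) by omega)]
        simp
    · rw [opMul_supp dK h₁' q (by omega), opMul_supp dK h₂' q (by omega)]

lemma exists_syz {L₁ L₂ : ℕ → K} {o₁ o₂ : ℕ} (h₁ : L₁ o₁ ≠ 0) (h₂ : L₂ o₂ ≠ 0)
    (h₁' : ∀ m, o₁ < m → L₁ m = 0) (h₂' : ∀ m, o₂ < m → L₂ m = 0) :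
    ∃ A B : ℕ → K, (∀ m, o₂ < m → A m = 0) ∧ (∀ m, o₁ < m → B m = 0) ∧ A o₂ = L₂ o₂ ∧
      B o₁ = L₁ o₁ ∧ (∀ q, opMul dK o₂ A L₁ q = opMul dK o₁ B L₂ q) := by
  obtain ⟨A, B, hA, hB, h0, h⟩ := exists_syz0 dK h₁' h₂'
  have key : ∃ A B : ℕ → K, (∀ m, o₂ < m → A m = 0) ∧ (∀ m, o₁ < m → B m = 0) ∧ A o₂ ≠ 0 ∧
      (∀ q, opMul dK o₂ A L₁ q = opMul dK o₁ B L₂ q) := by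
    rcases exists_deg hA with a0 | ⟨s, hs, as, ha⟩ <;>
      rcases exists_deg hB with b0 | ⟨t, ht, bt, hb⟩
    · exact absurd ⟨a0, b0⟩ h0
    · have := h (t + o₂)
      rw [opMul_zero dK _ a0, opMul_ext dK ht hb, opMul_lead dK h₂'] at this
      exact absurd this.symm (mul_ne_zero bt h₂)
    · have := h (s + o₁)
      rw [opMul_zero dK _ b0, opMul_ext dK hs ha, opMul_lead dK h₁'] at this
      exact absurd this (mul_ne_zero as h₁)
    · have h' : ∀ q, opMul dK s A L₁ q = opMul dK t B L₂ q := by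
        intro q
        rw [← opMul_ext dK hs ha, h, opMul_ext dK ht hb]
      rcases lt_trichotomy (s + o₁) (t + o₂) with hlt | heq | hlt
      · have := h' (t + o₂)
        rw [opMul_supp dK h₁' _ hlt, opMul_lead dK h₂'] at this
        exact absurd this.symm (mul_ne_zero bt h₂)
      · exact syz_up dK (o₂ - s) s t A B (by omega) (by omega) ha hb as h'
      · have := h' (s + o₁)
        rw [opMul_supp dK h₂' _ hlt, opMul_lead dK h₁'] at this
        exact absurd this (mul_ne_zero as h₁)
  obtain ⟨A, B, hA, hB, h0, h⟩ := key
  have hl := h (o₂ + o₁)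
  rw [opMul_lead dK h₁', add_comm, opMul_lead dK h₂'] at hl
  refine ⟨fun m => L₂ o₂ / A o₂ * A m, fun m => L₂ o₂ / A o₂ * B m, ?_, ?_, ?_, ?_, ?_⟩
  · intro m hm; simp [hA m hm]
  · intro m hm; simp [hB m hm]
  · field_simp
  · field_simp
    linear_combination -hl
  · intro q
    have := h q
    simp only [opMul, mul_assoc, ← Finset.mul_sum] at this ⊢
    rw [this]

lemma iter_Lop {E : Type*} [CommRing E] [Algebra K E] (δ : Derivation ℤ E E)
    (hδ : Compat dK δ) {L : ℕ → K} {o : ℕ} (h : ∀ m, o < m → L m = 0) (u : E) (k : ℕ) :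
    (⇑δ)^[k] (Lop δ L o u) = Lop δ (dIter (⇑dK) k L) (k + o) u := by
  induction k with
  | zero => simp [dIter]
  | succ k ih =>
    rw [Function.iterate_succ_apply', ih, dIter_succ_apply]
    have hs := dIter_supp dK h k
    generalize dIter (⇑dK) k L = c at hs
    simp only [Lop, dstep, map_sum, Derivation.leibniz, smul_eq_mul, map_add, add_mul,
      Finset.sum_add_distrib, hδ _, ← Function.iterate_succ_apply' (⇑δ)]
    congr 1
    · rw [show k + 1 + o + 1 = (k + o + 1) + 1 by ring, Finset.sum_range_succ' _ (k + o + 1)]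
      simp
    · rw [show k + 1 + o + 1 = (k + o + 1) + 1 by ring, Finset.sum_range_succ _ (k + o + 1)]
      simp [hs (k + o + 1) (by omega), mul_comm]

lemma Lop_ext {E : Type*} [CommRing E] [Algebra K E] (δ : Derivation ℤ E E)
    {c : ℕ → K} {s t : ℕ} (hst : s ≤ t) (hc : ∀ m, s < m → c m = 0) (u : E) :
    Lop δ c s u = Lop δ c t u := by
  refine Finset.sum_subset (by intro x; simp; omega) ?_
  intro m _ hm
  rw [Finset.mem_range] at hm
  rw [hc m (by omega), map_zero, zero_mul]

lemma sum_iter_Lop {E : Type*} [CommRing E] [Algebra K E] (δ : Derivation ℤ E E)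
    (hδ : Compat dK δ) {L : ℕ → K} {o : ℕ} (h : ∀ m, o < m → L m = 0) (u : E) (s : ℕ)
    (A : ℕ → K) :
    ∑ m ∈ Finset.range (s + 1), algebraMap K E (A m) * (⇑δ)^[m] (Lop δ L o u) =
      Lop δ (opMul dK s A L) (s + o) u := by
  have : ∀ m ∈ Finset.range (s + 1), algebraMap K E (A m) * (⇑δ)^[m] (Lop δ L o u) =
      algebraMap K E (A m) * Lop δ (dIter (⇑dK) m L) (s + o) u := by
    intro m hm
    rw [Finset.mem_range] at hm
    rw [iter_Lop dK δ hδ h, Lop_ext δ (show m + o ≤ s + o by omega) (dIter_supp dK h m)]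
  rw [Finset.sum_congr rfl this]
  simp only [Lop, opMul, map_sum, Finset.mul_sum, Finset.sum_mul, map_mul]
  rw [Finset.sum_comm]
  simp only [mul_assoc]

end Helpers

open MvPolynomial in
lemma det_minor {K : Type*} [Field K] (dK : Derivation ℤ K K)
    (o₁ o₂ : ℕ) (L₁ L₂ : ℕ → K)
    (h₁' : ∀ m, o₁ < m → L₁ m = 0) (h₂' : ∀ m, o₂ < m → L₂ m = 0) :
    ∃ e : ℕ, Matrix.det (Matrix.of fun r q : Fin (o₁ + o₂ + 1) =>
        if (r : ℕ) < o₂ + 1 then dIter (⇑dK) (r : ℕ) L₁ (q : ℕ)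
        else dIter (⇑dK) ((r : ℕ) - (o₂ + 1)) L₂ (q : ℕ)) =
      (-1) ^ e * (L₁ o₁ * (Matrix.det (Matrix.of fun r q : Fin (o₁ + o₂) =>
            if (r : ℕ) < o₂ then dIter (⇑dK) (r : ℕ) L₁ (q : ℕ)
            else dIter (⇑dK) ((r : ℕ) - o₂) L₂ (q : ℕ)))) := by
  rw [Matrix.det_succ_column _ (Fin.last _),
    Finset.sum_eq_single (⟨o₂, by omega⟩ : Fin (o₁ + o₂ + 1))]
  · refine ⟨o₂ + (o₁ + o₂), ?_⟩
    rw [mul_assoc]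
    congr 2
    · simp only [Matrix.of_apply, Fin.val_last]
      rw [if_pos (by omega), add_comm o₁ o₂, dIter_lead dK h₁']
    · congr 1
      ext r q
      simp only [Matrix.submatrix_apply, Matrix.of_apply, Fin.succAbove_last, Fin.val_castSucc,
        Fin.succAbove, Fin.lt_def]
      by_cases hr : (r : ℕ) < o₂
      · simp [hr, Nat.lt_succ_of_lt hr]
      · simp [hr]
  · intro r _ hr
    have hr' : (r : ℕ) ≠ o₂ := fun h => hr (Fin.ext h)
    have := r.2
    simp only [Matrix.of_apply, Fin.val_last]
    split_ifs with h
    · rw [dIter_supp dK h₁' _ _ (by omega)]; simp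
    · rw [dIter_supp dK h₂' _ _ (by omega)]; simp
  · simp

open MvPolynomial in
/-- For the system `x₁ = a₁ − L₁(u)`, `x₂ = a₂ − L₂(u)` with
`L₁, L₂ ∈ K[∂]` of orders `o₁, o₂` and `gcrd(L₁, L₂) = 1` (expressed by a Bézout identity),
there are `D₁, D₂ ∈ K[∂]` with `deg D_i ≤ o_i − 1` such that
`∂Res(F₁, F₂) = (−1)^a · ∂Res^h(H₁, H₂) · [(L₂−D₂)(x₁−a₁) − (L₁−D₁)(x₂−a₂)]` for some
`a ∈ ℕ`;  here `∂Res(F₁,F₂)` is the determinant of the `(o₁+o₂+2)`-square coefficient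
matrix of `{∂^{o₂}F₁,…,F₁,∂^{o₁}F₂,…,F₂}` over `K{x₁,x₂}` and `∂Res^h(H₁,H₂)` the
determinant of the `(o₁+o₂)`-square coefficient matrix of
`{∂^{o₂−1}H₁,…,H₁,∂^{o₁−1}H₂,…,H₂}`.  In particular the bracketed polynomial vanishes
identically under the substitution `x_i ↦ a_i − L_i(u)` in every differential
`K`-algebra. -/
theorem dRes_formula_n2
    {K : Type*} [Field K] (dK : Derivation ℤ K K)
    (o₁ o₂ : ℕ) (a₁ a₂ : K) (L₁ L₂ : ℕ → K)
    (h₁ : L₁ o₁ ≠ 0) (h₂ : L₂ o₂ ≠ 0)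
    (h₁' : ∀ m, o₁ < m → L₁ m = 0) (h₂' : ∀ m, o₂ < m → L₂ m = 0)
    (hcop : ∃ (b₁ b₂ : ℕ → K) (d₁ d₂ : ℕ),
      ∀ (E : Type*) [CommRing E] [Algebra K E] (δ : Derivation ℤ E E),
        Compat dK δ → ∀ x : E,
          Lop δ b₁ d₁ (Lop δ L₁ o₁ x) + Lop δ b₂ d₂ (Lop δ L₂ o₂ x) = x) :
    ∃ D₁ D₂ : ℕ → K,
      (∀ m, o₁ ≤ m → D₁ m = 0) ∧ (∀ m, o₂ ≤ m → D₂ m = 0) ∧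
      (∃ aexp : ℕ,
        Matrix.det (Matrix.of fun r q : Fin (o₁ + o₂ + 2) =>
          if (r : ℕ) < o₂ + 1 then
            (if (q : ℕ) < o₁ + o₂ + 1 then
              (C (dIter (⇑dK) (r : ℕ) L₁ (q : ℕ)) : MvPolynomial (Fin 2 × ℕ) K)
            else X ((0 : Fin 2), (r : ℕ)) - C ((⇑dK)^[(r : ℕ)] a₁))
          else
            (if (q : ℕ) < o₁ + o₂ + 1 then
              C (dIter (⇑dK) ((r : ℕ) - (o₂ + 1)) L₂ (q : ℕ))
            else X ((1 : Fin 2), ((r : ℕ) - (o₂ + 1))) -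
              C ((⇑dK)^[(r : ℕ) - (o₂ + 1)] a₂))) =
        (-1 : MvPolynomial (Fin 2 × ℕ) K) ^ aexp *
          C (Matrix.det (Matrix.of fun r q : Fin (o₁ + o₂) =>
            if (r : ℕ) < o₂ then dIter (⇑dK) (r : ℕ) L₁ (q : ℕ)
            else dIter (⇑dK) ((r : ℕ) - o₂) L₂ (q : ℕ))) *
          ((∑ m ∈ Finset.range (o₂ + 1), C (L₂ m - D₂ m) *
              (X ((0 : Fin 2), m) - C ((⇑dK)^[m] a₁))) -
           (∑ m ∈ Finset.range (o₁ + 1), C (L₁ m - D₁ m) *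
              (X ((1 : Fin 2), m) - C ((⇑dK)^[m] a₂))))) ∧
      ∀ (E : Type*) [CommRing E] [Algebra K E] (δ : Derivation ℤ E E),
        Compat dK δ → ∀ u : E,
          (∑ m ∈ Finset.range (o₂ + 1), algebraMap K E (L₂ m - D₂ m) *
              (⇑δ)^[m] ((algebraMap K E a₁ - Lop δ L₁ o₁ u) - algebraMap K E a₁)) -
          (∑ m ∈ Finset.range (o₁ + 1), algebraMap K E (L₁ m - D₁ m) *
              (⇑δ)^[m] ((algebraMap K E a₂ - Lop δ L₂ o₂ u) - algebraMap K E a₂)) = 0 := by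
  obtain ⟨A, B, hA, hB, hAo, hBo, hAB⟩ := exists_syz dK h₁ h₂ h₁' h₂'
  refine ⟨fun m => L₁ m - B m, fun m => L₂ m - A m, ?_, ?_, ?_, ?_⟩
  · intro m hm
    rcases Nat.eq_or_lt_of_le hm with rfl | hm
    · simp [hBo]
    · simp [hB m hm, h₁' m hm]
  · intro m hm
    rcases Nat.eq_or_lt_of_le hm with rfl | hm
    · simp [hAo]
    · simp [hA m hm, h₂' m hm]
  · simp only [sub_sub_cancel]
    obtain ⟨e, he⟩ := det_minor dK o₁ o₂ L₁ L₂ h₁' h₂'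
    set R := Matrix.det (Matrix.of fun r q : Fin (o₁ + o₂) =>
            if (r : ℕ) < o₂ then dIter (⇑dK) (r : ℕ) L₁ (q : ℕ)
            else dIter (⇑dK) ((r : ℕ) - o₂) L₂ (q : ℕ)) with hR
    set Br : MvPolynomial (Fin 2 × ℕ) K := (∑ m ∈ Finset.range (o₂ + 1), C (A m) *
              (X ((0 : Fin 2), m) - C ((⇑dK)^[m] a₁))) -
           (∑ m ∈ Finset.range (o₁ + 1), C (B m) *
              (X ((1 : Fin 2), m) - C ((⇑dK)^[m] a₂))) with hBr
    set M : Matrix (Fin (o₁ + o₂ + 2)) (Fin (o₁ + o₂ + 2)) (MvPolynomial (Fin 2 × ℕ) K) :=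
      Matrix.of fun r q : Fin (o₁ + o₂ + 2) =>
          if (r : ℕ) < o₂ + 1 then
            (if (q : ℕ) < o₁ + o₂ + 1 then
              (C (dIter (⇑dK) (r : ℕ) L₁ (q : ℕ)) : MvPolynomial (Fin 2 × ℕ) K)
            else X ((0 : Fin 2), (r : ℕ)) - C ((⇑dK)^[(r : ℕ)] a₁))
          else
            (if (q : ℕ) < o₁ + o₂ + 1 then
              C (dIter (⇑dK) ((r : ℕ) - (o₂ + 1)) L₂ (q : ℕ))
            else X ((1 : Fin 2), ((r : ℕ) - (o₂ + 1))) -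
              C ((⇑dK)^[(r : ℕ) - (o₂ + 1)] a₂)) with hM
    let v : Fin (o₁ + o₂ + 2) → MvPolynomial (Fin 2 × ℕ) K := fun r =>
      if (r : ℕ) < o₂ + 1 then C (A r) else - C (B ((r : ℕ) - (o₂ + 1)))
    have hsum : ∀ f g : ℕ → MvPolynomial (Fin 2 × ℕ) K,
        ∑ r : Fin (o₁ + o₂ + 2), v r * (if (r : ℕ) < o₂ + 1 then f r else g (r - (o₂ + 1))) =
        ∑ m ∈ Finset.range (o₂ + 1), C (A m) * f m -
          ∑ m ∈ Finset.range (o₁ + 1), C (B m) * g m := by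
      intro f g
      rw [Fin.sum_univ_eq_sum_range (fun r => (if r < o₂ + 1 then C (A r) else
        - C (B (r - (o₂ + 1)))) * (if r < o₂ + 1 then f r else g (r - (o₂ + 1)))),
        show o₁ + o₂ + 2 = (o₂ + 1) + (o₁ + 1) by ring, Finset.sum_range_add, sub_eq_add_neg,
        ← Finset.sum_neg_distrib]
      congr 1
      · refine Finset.sum_congr rfl fun m hm => ?_
        rw [Finset.mem_range] at hm
        simp [hm]
      · refine Finset.sum_congr rfl fun m hm => ?_
        rw [if_neg (show ¬ (o₂ + 1 + m < o₂ + 1) by omega),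
          if_neg (show ¬ (o₂ + 1 + m < o₂ + 1) by omega)]
        simp
    have hrow : ∀ q : Fin (o₁ + o₂ + 2), (∑ k, v k • M k) q =
        if (q : ℕ) < o₁ + o₂ + 1 then 0 else Br := by
      intro q
      rw [Finset.sum_apply]
      simp only [Pi.smul_apply, smul_eq_mul, hM, Matrix.of_apply]
      by_cases hq : (q : ℕ) < o₁ + o₂ + 1
      · simp only [hq, if_true]
        rw [hsum (fun r => C (dIter (⇑dK) r L₁ (q : ℕ))) (fun r => C (dIter (⇑dK) r L₂ (q : ℕ)))]
        have := congrArg (C : K → MvPolynomial (Fin 2 × ℕ) K) (hAB q)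
        simp only [opMul, map_sum, map_mul] at this
        rw [this, sub_self]
      · simp only [hq, if_false]
        exact hsum (fun r => X ((0 : Fin 2), r) - C ((⇑dK)^[r] a₁))
          (fun r => X ((1 : Fin 2), r) - C ((⇑dK)^[r] a₂))
    have hdet := Matrix.det_updateRow_sum M (Fin.last (o₁ + o₂ + 1)) v
    have hvl : v (Fin.last (o₁ + o₂ + 1)) = - C (L₁ o₁) := by
      simp only [v, Fin.val_last]
      rw [if_neg (by omega), show o₁ + o₂ + 1 - (o₂ + 1) = o₁ by omega, hBo]
    have hexp : (M.updateRow (Fin.last (o₁ + o₂ + 1)) (∑ k, v k • M k)).det =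
        Br * C ((-1) ^ e * (L₁ o₁ * R)) := by
      rw [Matrix.det_succ_row _ (Fin.last _), Finset.sum_eq_single (Fin.last _)]
      · rw [Matrix.updateRow_self, hrow, if_neg (by simp), ← he, RingHom.map_det,
          Even.neg_one_pow (by simp), one_mul]
        congr 2
        ext1 r q
        simp only [Matrix.submatrix_apply, Fin.succAbove_last, RingHom.mapMatrix_apply,
          Matrix.map_apply, Matrix.of_apply]
        rw [Matrix.updateRow_ne (Fin.castSucc_lt_last r).ne]
        simp only [hM, Matrix.of_apply, Fin.val_castSucc, q.2, if_true]
        split_ifs <;> rfl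
      · intro q _ hq
        have : (q : ℕ) < o₁ + o₂ + 1 := Fin.val_lt_last hq
        rw [Matrix.updateRow_self, hrow, if_pos this]
        simp
      · simp
    rw [hexp, hvl, smul_eq_mul] at hdet
    refine ⟨e + 1, ?_⟩
    have hne : (C (L₁ o₁) : MvPolynomial (Fin 2 × ℕ) K) ≠ 0 := by simpa using h₁
    apply mul_left_cancel₀ hne
    simp only [map_mul, map_pow, map_neg, map_one] at hdet
    rw [pow_succ]
    linear_combination hdet
  · intro E _ _ δ hδ u
    have hn : ∀ (m : ℕ) (x : E), (⇑δ)^[m] (-x) = -((⇑δ)^[m] x) := fun m x =>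
      iterate_map_neg δ m x
    simp only [sub_sub_cancel, sub_sub_cancel_left, hn, mul_neg, Finset.sum_neg_distrib]
    rw [sum_iter_Lop dK δ hδ h₁', sum_iter_Lop dK δ hδ h₂', funext hAB, add_comm o₁ o₂, sub_self]
end
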